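/- Let Γ be a finite-index subgroup of SL₂(ℤ), k ≥ 1 an integer, and fix parameters x, y, u, v ∈ ℂ. Let z, w ∈ ℍ with γ·z ≠ w for every γ ∈ Γ. Define G(z,w) = Σ_{γ=(a,b;c,d)∈Γ} g_k(γ·z, w), where in the γ-th term the parameters (x,y) are replaced by (a·x + b·y, c·x + d·y) and (u,v) are unchanged. Then this family is summable, and the function ζ ↦ G(ζ, w) has at z the ℝ-Fréchet derivative ν ↦ A·ν + B·conj(ν), where A = (x − z·y)^{k}·Σ_{p+q=k, p,q≥0} Ψ_Γ^{p,q}(z,w)·(u − w·v)^{p}·(u − conj(w)·v)^{q} and B = (x − conj(z)·y)^{k}·Σ_{p+q=k, p,q≥0} conj(Ψ_Γ^{q,p}(z,w))·(u − w·v)^{p}·(u − conj(w)·v)^{q}. -/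

import Mathlib

/- STATEMENT 15: The vector-valued higher Green's function
`G(z,w) = Σ_{γ∈Γ} g_k(γ·z, w)|_{(γ,1)}` is summable and is a harmonic lift,
with respect to `z`, of the meromorphic modular forms `Ψ_Γ^{p,q}(z,w)`. -/

open Complex ComplexConjugate

noncomputable section

abbrev SL2Z := Matrix.SpecialLinearGroup (Fin 2) ℤ

/-- The real matrix associated to an element of `SL₂(ℤ)`. -/
def toRealM (γ : SL2Z) : Matrix (Fin 2) (Fin 2) ℝ :=
  γ.val.map fun n => (n : ℝ)

/-- Automorphy factor `j_γ(z) = c·z + d` for a real matrix `γ = (a, b; c, d)`. -/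
def jFac (γ : Matrix (Fin 2) (Fin 2) ℝ) (z : ℂ) : ℂ :=
  ((γ 1 0 : ℝ) : ℂ) * z + ((γ 1 1 : ℝ) : ℂ)

/-- Möbius action `γ·z = (a·z + b)/(c·z + d)`. -/
def moeb (γ : Matrix (Fin 2) (Fin 2) ℝ) (z : ℂ) : ℂ :=
  (((γ 0 0 : ℝ) : ℂ) * z + ((γ 0 1 : ℝ) : ℂ)) / (((γ 1 0 : ℝ) : ℂ) * z + ((γ 1 1 : ℝ) : ℂ))

/-- Complex entries of an element of `SL₂(ℤ)`. -/
def entC (γ : SL2Z) (i j : Fin 2) : ℂ := ((toRealM γ i j : ℝ) : ℂ)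

/-- `ψ^{p,q}(z,w) = (w − conj w)/((z − w)^(p+1)·(z − conj w)^(q+1))`. -/
def psiPQ (p q : ℤ) (z w : ℂ) : ℂ :=
  (w - conj w) / ((z - w) ^ (p + 1) * (z - conj w) ^ (q + 1))

/-- The meromorphic Poincaré series `Ψ_Γ^{p,q}(z,w)`. -/
def PsiS (Γ : Subgroup SL2Z) (p q : ℤ) (z w : ℂ) : ℂ :=
  ∑' γ : Γ, jFac (toRealM ↑γ) z ^ (-(p + q + 2)) * psiPQ p q (moeb (toRealM ↑γ) z) w

/-- `p_k(z,w) = −Σ_{p=1}^k (1/p)·((x − zy)(u − wv)/(z − w))^p·(vx − uy)^{k−p}`. -/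
def pkF (k : ℕ) (x y u v z w : ℂ) : ℂ :=
  -(∑ p ∈ Finset.Icc 1 k, (1 / (p : ℂ)) *
      (((x - z * y) * (u - w * v)) / (z - w)) ^ p * (v * x - u * y) ^ (k - p))

/-- The generating function `g_k(z,w)` of the higher Green's functions. -/
def gkF (k : ℕ) (x y u v z w : ℂ) : ℂ :=
  pkF k x y u v z w - pkF k x y u v z (conj w) - pkF k x y u v (conj z) w +
    pkF k x y u v (conj z) (conj w) +
    (v * x - u * y) ^ k *
      ((Real.log (Complex.normSq (z - w) / Complex.normSq (z - conj w)) : ℝ) : ℂ)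

/-- The continuous ℝ-linear map `v ↦ a·v + b·conj v`. -/
def wirt (a b : ℂ) : ℂ →L[ℝ] ℂ :=
  a • (ContinuousLinearMap.id ℝ ℂ) + b • (Complex.conjCLE.toContinuousLinearMap)

lemma wirt_apply (a b ν : ℂ) : wirt a b ν = a * ν + b * conj ν := by
  simp [wirt]

lemma geom_sum_difference {R : Type*} [CommRing R] (α β U X v y : R) (k : ℕ) :
    (∑ i ∈ Finset.range k, (X * (v + U * α)) ^ i * (v * X - y * U) ^ (k - 1 - i)) *
        ((v + U * α) * (X * α + y)) -
      (∑ i ∈ Finset.range k, (X * (v + U * β)) ^ i * (v * X - y * U) ^ (k - 1 - i)) *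
        ((v + U * β) * (X * β + y)) + (v * X - y * U) ^ k * (α - β) =
    X ^ k * (α - β) * ∑ p ∈ Finset.range (k + 1), (v + U * α) ^ p * (v + U * β) ^ (k - p) := by
  induction k with
  | zero => simp
  | succ k ih =>
    have hh : (∑ i ∈ Finset.range (k + 1), (v + U * α) ^ i * (v + U * β) ^ (k - i)) *
        (U * α - U * β) = (v + U * α) ^ (k + 1) - (v + U * β) ^ (k + 1) := by
      have := geom_sum₂_mul (v + U * α) (v + U * β) (k + 1)
      simp only [Nat.add_sub_cancel] at this
      rw [← this]; ring
    rw [geom_sum₂_succ_eq (v + U * α) (v + U * β) (n := k + 1)]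
    simp only [Nat.add_sub_cancel]
    rw [geom_sum₂_succ_eq (X * (v + U * α)), geom_sum₂_succ_eq (X * (v + U * β))]
    simp only [mul_pow] at ih hh ⊢
    linear_combination (v * X - y * U) * ih - (X ^ k * y + X ^ (k + 1) * β) * hh

/-- The holomorphic derivative of `pkF` in its variable `z`. -/
def pkDeriv (k : ℕ) (x y u v z w : ℂ) : ℂ :=
  (∑ i ∈ Finset.range k, ((x - z * y) * (u - w * v) / (z - w)) ^ i *
    (v * x - u * y) ^ (k - 1 - i)) * ((u - w * v) * (x - w * y) / (z - w) ^ 2)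

lemma hasDerivAt_pkF (k : ℕ) (x y u v : ℂ) {z w : ℂ} (h : z ≠ w) :
    HasDerivAt (fun ζ => pkF k x y u v ζ w) (pkDeriv k x y u v z w) z := by
  have h0 : z - w ≠ 0 := sub_ne_zero.mpr h
  have hT : HasDerivAt (fun ζ => (x - ζ * y) * (u - w * v) / (ζ - w))
      (-((u - w * v) * (x - w * y) / (z - w) ^ 2)) z := by
    have h1 : HasDerivAt (fun ζ : ℂ => (x - ζ * y) * (u - w * v)) (-(1 * y) * (u - w * v)) z :=
      (((hasDerivAt_id z).mul_const y).const_sub x).mul_const _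
    refine (h1.fun_div ((hasDerivAt_id z).sub_const w) h0).congr_deriv ?_
    simp only [id]
    rw [← neg_div]
    congr 1
    ring
  have hs := HasDerivAt.fun_sum (u := Finset.Icc 1 k) fun p _ =>
    (((hT.fun_pow p).const_mul (1 / (p : ℂ))).mul_const ((v * x - u * y) ^ (k - p)))
  have hIcc : Finset.Icc 1 k = (Finset.range k).map (addRightEmbedding 1) := by
    ext i
    simp only [Finset.mem_Icc, Finset.mem_map, Finset.mem_range, addRightEmbedding_apply]
    exact ⟨fun hi => ⟨i - 1, by omega, by omega⟩, fun ⟨j, hj, hji⟩ => by omega⟩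
  refine hs.fun_neg.congr_deriv ?_
  rw [pkDeriv, Finset.sum_mul, ← Finset.sum_neg_distrib, hIcc, Finset.sum_map]
  refine Finset.sum_congr rfl fun i _ => ?_
  have hi : ((i : ℂ) + 1) ≠ 0 := by exact_mod_cast i.succ_ne_zero
  simp only [addRightEmbedding_apply, Nat.add_sub_cancel, Nat.cast_add, Nat.cast_one,
    Nat.sub_sub, Nat.add_comm 1 i]
  rw [one_div]
  linear_combination (((x - z * y) * (u - w * v) / (z - w)) ^ i *
    (v * x - u * y) ^ (k - (i + 1)) * ((u - w * v) * (x - w * y) / (z - w) ^ 2)) *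
    (inv_mul_cancel₀ hi)

/-- The difference of holomorphic derivatives at two parameters is a sum of `ψ^{p,q}`. -/
lemma pkDeriv_sub_pkDeriv (k : ℕ) (x y u v : ℂ) {z w₁ w₂ : ℂ} (h₁ : z ≠ w₁) (h₂ : z ≠ w₂) :
    pkDeriv k x y u v z w₁ - pkDeriv k x y u v z w₂ +
      (v * x - u * y) ^ k * (1 / (z - w₁) - 1 / (z - w₂)) =
    (x - z * y) ^ k * ∑ p ∈ Finset.range (k + 1),
      (w₁ - w₂) / ((z - w₁) ^ (p + 1) * (z - w₂) ^ (k - p + 1)) *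
        (u - w₁ * v) ^ p * (u - w₂ * v) ^ (k - p) := by
  have h₁' : z - w₁ ≠ 0 := sub_ne_zero.mpr h₁
  have h₂' : z - w₂ ≠ 0 := sub_ne_zero.mpr h₂
  have key := geom_sum_difference (1 / (z - w₁)) (1 / (z - w₂)) (u - z * v) (x - z * y) v y k
  have hL : v * (x - z * y) - y * (u - z * v) = v * x - u * y := by ring
  have hs (w : ℂ) (h : z - w ≠ 0) :
      v + (u - z * v) * (1 / (z - w)) = (u - w * v) / (z - w) := by
    field_simp; ring
  have hx (w : ℂ) (h : z - w ≠ 0) :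
      (x - z * y) * (1 / (z - w)) + y = (x - w * y) / (z - w) := by
    field_simp; ring
  rw [hL, hs _ h₁', hs _ h₂', hx _ h₁', hx _ h₂'] at key
  convert key using 1
  · simp only [pkDeriv, sq, div_mul_div_comm, mul_div_assoc]
  · rw [mul_assoc, Finset.mul_sum _ _ (1 / (z - w₁) - 1 / (z - w₂))]
    refine congrArg _ ?_
    refine Finset.sum_congr rfl fun p _ => ?_
    rw [div_pow, div_pow, pow_succ, pow_succ]
    field_simp
    ring

lemma hasFDerivAt_log_normSq {z w : ℂ} (h : z ≠ w) :
    HasFDerivAt (fun ζ : ℂ => ((Real.log (Complex.normSq (ζ - w)) : ℝ) : ℂ))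
      (wirt (1 / (z - w)) (1 / (conj z - conj w))) z := by
  have h0 : z - w ≠ 0 := sub_ne_zero.mpr h
  have hn : Complex.normSq (z - w) ≠ 0 := by simpa using h0
  have hre : HasFDerivAt (fun ζ : ℂ => (ζ - w).re) Complex.reCLM z :=
    Complex.reCLM.hasFDerivAt.comp z ((hasFDerivAt_id z).sub_const w)
  have him : HasFDerivAt (fun ζ : ℂ => (ζ - w).im) Complex.imCLM z :=
    Complex.imCLM.hasFDerivAt.comp z ((hasFDerivAt_id z).sub_const w)
  have hN := ((hre.mul hre).add (him.mul him)).log hn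
  refine (Complex.ofRealCLM.hasFDerivAt.comp z hN).congr_fderiv ?_
  refine ContinuousLinearMap.ext fun ν => ?_
  rw [wirt_apply]
  have hd : conj z - conj w = conj (z - w) := (map_sub _ _ _).symm
  rw [hd, one_div, one_div, Complex.inv_def, Complex.inv_def, Complex.normSq_conj,
    Complex.conj_conj]
  apply Complex.ext <;> simp [Complex.normSq_apply] <;> ring

lemma hasFDerivAt_gkF (k : ℕ) (x y u v : ℂ) {z w : ℂ} (h : z ≠ w) (h' : z ≠ conj w) :
    HasFDerivAt (fun ζ => gkF k x y u v ζ w)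
      (wirt
        ((x - z * y) ^ k * ∑ p ∈ Finset.range (k + 1),
          psiPQ (p : ℤ) ((k - p : ℕ) : ℤ) z w * (u - w * v) ^ p * (u - conj w * v) ^ (k - p))
        ((x - conj z * y) ^ k * ∑ p ∈ Finset.range (k + 1),
          conj (psiPQ ((k - p : ℕ) : ℤ) (p : ℤ) z w) * (u - w * v) ^ p *
            (u - conj w * v) ^ (k - p))) z := by
  have hc {f : ℂ → ℂ} {a ζ : ℂ} (hf : HasDerivAt f a ζ) : HasFDerivAt f (wirt a 0) ζ := by
    refine (hf.hasFDerivAt.restrictScalars ℝ).congr_fderiv ?_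
    refine ContinuousLinearMap.ext fun ν => ?_
    simp [wirt_apply, mul_comm]
  have hcc {f : ℂ → ℂ} {a : ℂ} (hf : HasDerivAt f a (conj z)) :
      HasFDerivAt (fun ζ => f (conj ζ)) (wirt 0 a) z := by
    refine ((hc hf).comp z Complex.conjCLE.toContinuousLinearMap.hasFDerivAt).congr_fderiv ?_
    refine ContinuousLinearMap.ext fun ν => ?_
    simp [wirt_apply]
  have hz : conj z ≠ w := fun e => h' (by rw [← e, Complex.conj_conj])
  have hz' : conj z ≠ conj w := fun e => h ((starRingEnd ℂ).injective e)
  have hlog : HasFDerivAt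
      (fun ζ => ((Real.log (normSq (ζ - w) / normSq (ζ - conj w)) : ℝ) : ℂ))
      (wirt (1 / (z - w)) (1 / (conj z - conj w)) -
        wirt (1 / (z - conj w)) (1 / (conj z - conj (conj w)))) z := by
    refine ((hasFDerivAt_log_normSq h).sub (hasFDerivAt_log_normSq h')).congr_of_eventuallyEq ?_
    filter_upwards [isOpen_ne.mem_nhds h, isOpen_ne.mem_nhds h'] with ζ hζ hζ'
    simp only [Pi.sub_apply]
    rw [Real.log_div (by simpa using sub_ne_zero.mpr hζ) (by simpa using sub_ne_zero.mpr hζ'),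
      Complex.ofReal_sub]
  have hmain := ((((hc (hasDerivAt_pkF k x y u v h)).sub (hc (hasDerivAt_pkF k x y u v h'))).sub
    (hcc (hasDerivAt_pkF k x y u v hz))).add (hcc (hasDerivAt_pkF k x y u v hz'))).add
    (hlog.const_mul ((v * x - u * y) ^ k))
  have hA := pkDeriv_sub_pkDeriv k x y u v h h'
  have hB := pkDeriv_sub_pkDeriv k x y u v hz hz'
  have hpsi (p q : ℕ) (ζ : ℂ) : psiPQ (p : ℤ) (q : ℤ) ζ w =
      (w - conj w) / ((ζ - w) ^ (p + 1) * (ζ - conj w) ^ (q + 1)) := by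
    rw [psiPQ]
    norm_cast
  have hBs : ∑ p ∈ Finset.range (k + 1), conj (psiPQ ((k - p : ℕ) : ℤ) (p : ℤ) z w) *
        (u - w * v) ^ p * (u - conj w * v) ^ (k - p) =
      -∑ p ∈ Finset.range (k + 1), (w - conj w) /
        ((conj z - w) ^ (p + 1) * (conj z - conj w) ^ (k - p + 1)) *
        (u - w * v) ^ p * (u - conj w * v) ^ (k - p) := by
    rw [← Finset.sum_neg_distrib]
    refine Finset.sum_congr rfl fun p _ => ?_
    rw [hpsi]
    simp only [map_div₀, map_mul, map_pow, map_sub, Complex.conj_conj]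
    rw [← neg_sub w, mul_comm ((conj z - conj w) ^ _)]
    ring
  refine hmain.congr_fderiv ?_
  simp only [hpsi]
  rw [← hA]
  simp only [hpsi] at hBs
  rw [hBs, mul_neg, ← hB]
  refine ContinuousLinearMap.ext fun ν => ?_
  simp [wirt_apply]
  ring

/-- The sum of the absolute values of the entries of `γ`. -/
def entrySum (γ : SL2Z) : ℝ := |(γ 0 0 : ℝ)| + |(γ 0 1 : ℝ)| + |(γ 1 0 : ℝ)| + |(γ 1 1 : ℝ)|

lemma det_eq_one (γ : SL2Z) : γ 0 0 * γ 1 1 - γ 0 1 * γ 1 0 = 1 := by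
  rw [← Matrix.det_fin_two, γ.det_coe]

lemma one_le_entrySum (γ : SL2Z) : 1 ≤ entrySum γ := by
  have h : (1 : ℤ) ≤ |γ 1 0| + |γ 1 1| := by
    by_contra hlt
    have hc := abs_nonneg (γ 1 0)
    have hd := abs_nonneg (γ 1 1)
    have h0 : γ 1 0 = 0 := abs_eq_zero.mp (by omega)
    have h1 : γ 1 1 = 0 := abs_eq_zero.mp (by omega)
    have := det_eq_one γ
    simp [h0, h1] at this
  have h' : (1 : ℝ) ≤ |(γ 1 0 : ℝ)| + |(γ 1 1 : ℝ)| := by exact_mod_cast h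
  rw [entrySum]
  linarith [abs_nonneg (γ 0 0 : ℝ), abs_nonneg (γ 0 1 : ℝ)]

lemma eq_of_ediv_eq {b b' d n : ℤ} (hd : d ≠ 0) (h : b - b' = d * n) (hq : b / d = b' / d) :
    b = b' := by
  have hb : b = b' + n * d := by linear_combination h
  rw [hb, Int.add_mul_ediv_right _ _ hd] at hq
  have : n = 0 := by omega
  rw [hb, this]; ring

lemma abs_mul_abs_ediv_le (e m : ℤ) : |m| * |e / m| ≤ |e| + |m| := by
  rcases eq_or_ne m 0 with rfl | hm
  · simp
  · rw [← abs_mul]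
    have h1 := Int.mul_ediv_add_emod e m
    have h2 := Int.emod_nonneg e hm
    have h3 := Int.emod_lt_abs e hm
    have h4 : m * (e / m) = e - e % m := by linarith
    rw [h4]
    refine (abs_sub _ _).trans ?_
    rw [abs_of_nonneg h2]
    linarith

/-- The bottom row of `γ` together with a quotient recording which element of the coset of
upper unipotent translates `γ` is. -/
def rowQuot (γ : SL2Z) : (Fin 2 → ℤ) × ℤ :=
  (![γ 1 0, γ 1 1], if |γ 1 0| ≤ |γ 1 1| then γ 0 1 / γ 1 1 else γ 0 0 / γ 1 0)

lemma rowQuot_injective : Function.Injective rowQuot := by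
  intro γ δ h
  simp only [rowQuot, Prod.mk.injEq, Matrix.vecCons_inj, and_true] at h
  obtain ⟨⟨hc, hd⟩, hq⟩ := h
  have h1 := det_eq_one γ
  have h2 := det_eq_one δ
  rw [← hc, ← hd] at h2 hq
  have hb : γ 0 1 - δ 0 1 =
      γ 1 1 * (γ 0 0 * (γ 0 1 - δ 0 1) - γ 0 1 * (γ 0 0 - δ 0 0)) := by
    linear_combination -(γ 0 1 - δ 0 1) * h1 + γ 0 1 * (h1 - h2)
  have ha : γ 0 0 - δ 0 0 =
      γ 1 0 * (γ 0 0 * (γ 0 1 - δ 0 1) - γ 0 1 * (γ 0 0 - δ 0 0)) := by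
    linear_combination -(γ 0 0 - δ 0 0) * h1 + γ 0 0 * (h1 - h2)
  have key : γ 0 0 = δ 0 0 ∧ γ 0 1 = δ 0 1 := by
    split_ifs at hq with hle
    · have hd0 : γ 1 1 ≠ 0 := by
        intro h0
        have h0' : γ 1 0 = 0 := by simpa [h0] using hle
        simp [h0, h0'] at h1
      have hbb := eq_of_ediv_eq hd0 hb hq
      refine ⟨mul_right_cancel₀ hd0 ?_, hbb⟩
      linear_combination h1 - h2 + γ 1 0 * hbb
    · have hc0 : γ 1 0 ≠ 0 := by
        intro h0
        simp [h0] at hle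
      have haa := eq_of_ediv_eq hc0 ha hq
      refine ⟨haa, mul_right_cancel₀ hc0 ?_⟩
      linear_combination h2 - h1 + γ 1 1 * haa
  ext i j
  fin_cases i <;> fin_cases j
  exacts [key.1, key.2, hc, hd]

lemma norm_rowQuot_le (γ : SL2Z) :
    ‖(rowQuot γ).1‖ * ‖(![1, (rowQuot γ).2] : Fin 2 → ℤ)‖ ≤ entrySum γ := by
  have hn (m n : ℤ) : ‖(![m, n] : Fin 2 → ℤ)‖ = ((max |m| |n| : ℤ) : ℝ) := by
    simp [EisensteinSeries.norm_eq_max_natAbs]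
  have hN : entrySum γ = ((|γ 0 0| + |γ 0 1| + |γ 1 0| + |γ 1 1| : ℤ) : ℝ) := by
    simp [entrySum]
  rw [rowQuot]
  simp only [hn, hN]
  rw [← Int.cast_mul, Int.cast_le]
  have ha := abs_nonneg (γ 0 0)
  have hb := abs_nonneg (γ 0 1)
  have hc := abs_nonneg (γ 1 0)
  have hd := abs_nonneg (γ 1 1)
  split_ifs with hle
  · rw [max_eq_right hle, mul_max_of_nonneg _ _ hd]
    have := abs_mul_abs_ediv_le (γ 0 1) (γ 1 1)
    simp only [abs_one, mul_one]
    exact max_le (by linarith) (by linarith)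
  · rw [max_eq_left (le_of_not_ge hle), mul_max_of_nonneg _ _ hc]
    have := abs_mul_abs_ediv_le (γ 0 0) (γ 1 0)
    simp only [abs_one, mul_one]
    exact max_le (by linarith) (by linarith)

lemma summable_entrySum_inv_cube : Summable fun γ : SL2Z => (entrySum γ)⁻¹ ^ 3 := by
  have h1 : Summable fun r : Fin 2 → ℤ => ‖r‖⁻¹ ^ 3 := by
    have := EisensteinSeries.summable_one_div_norm_rpow (k := 3) (by norm_num)
    refine this.congr fun r => ?_
    rw [Real.rpow_neg (norm_nonneg _), inv_pow]
    norm_cast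
  have h2 : Summable fun q : ℤ => ‖(![1, q] : Fin 2 → ℤ)‖⁻¹ ^ 3 :=
    h1.comp_injective (i := fun q : ℤ => (![1, q] : Fin 2 → ℤ)) fun q q' h => by simpa using h
  have h3 := (h1.mul_of_nonneg h2 (fun _ => by positivity) (fun _ => by positivity)).comp_injective
    rowQuot_injective
  refine h3.of_nonneg_of_le (fun γ => ?_) fun γ => ?_
  · have := one_le_entrySum γ
    positivity
  · simp only [Function.comp_apply]
    rw [← mul_pow, ← mul_inv]
    have hpos : 0 < ‖(rowQuot γ).1‖ * ‖(![1, (rowQuot γ).2] : Fin 2 → ℤ)‖ := by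
      refine mul_pos (norm_pos_iff.mpr fun h => ?_) (norm_pos_iff.mpr fun h => ?_)
      · have h0 : γ 1 0 = 0 := congrFun h 0
        have h1 : γ 1 1 = 0 := congrFun h 1
        have := det_eq_one γ
        simp [h0, h1] at this
      · exact one_ne_zero (congrFun h 0)
    exact pow_le_pow_left₀ (inv_nonneg.mpr (zero_le_one.trans (one_le_entrySum γ)))
      (inv_anti₀ hpos (norm_rowQuot_le γ)) 3

lemma eventually_lt_entrySum (M : ℝ) : ∀ᶠ γ : SL2Z in Filter.cofinite, M < entrySum γ := by
  have hM : 0 < max M 1 := by positivity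
  have h := summable_entrySum_inv_cube.tendsto_cofinite_zero.eventually_lt_const
    (show (0 : ℝ) < (max M 1)⁻¹ ^ 3 by positivity)
  filter_upwards [h] with γ hγ
  have h1 := one_le_entrySum γ
  have := lt_of_pow_lt_pow_left₀ 3 (by positivity) hγ
  exact (le_max_left _ _).trans_lt ((inv_lt_inv₀ (by linarith) hM).mp this)

/-- The automorphy factor of `γ⁻¹` at `w`. -/
def invFac (γ : SL2Z) (w : ℂ) : ℂ := (γ 0 0 : ℂ) - (γ 1 0 : ℂ) * w

/-- The point `γ⁻¹·w`. -/
def invMoeb (γ : SL2Z) (w : ℂ) : ℂ := ((γ 1 1 : ℂ) * w - (γ 0 1 : ℂ)) / invFac γ w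

lemma det_eq_one_complex (γ : SL2Z) : (γ 0 0 : ℂ) * γ 1 1 - γ 0 1 * γ 1 0 = 1 := by
  exact_mod_cast congrArg (Int.cast : ℤ → ℂ) (det_eq_one γ)

lemma conj_invFac (γ : SL2Z) (w : ℂ) : conj (invFac γ w) = invFac γ (conj w) := by
  simp [invFac]

lemma conj_invMoeb (γ : SL2Z) (w : ℂ) : conj (invMoeb γ w) = invMoeb γ (conj w) := by
  simp [invMoeb, conj_invFac]

lemma invFac_ne_zero (γ : SL2Z) {w : ℂ} (hw : w.im ≠ 0) : invFac γ w ≠ 0 := by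
  intro h
  have him := congrArg Complex.im h
  have hre := congrArg Complex.re h
  simp [invFac, hw] at him
  simp [invFac, him] at hre
  have := det_eq_one γ
  simp [him, hre] at this

lemma invMoeb_mul_invFac (γ : SL2Z) {w : ℂ} (hw : w.im ≠ 0) :
    invMoeb γ w * invFac γ w = (γ 1 1 : ℂ) * w - (γ 0 1 : ℂ) :=
  div_mul_cancel₀ _ (invFac_ne_zero γ hw)

lemma invMoeb_sub_conj (γ : SL2Z) {w : ℂ} (hw : w.im ≠ 0) :
    invMoeb γ w - conj (invMoeb γ w) = (w - conj w) / (invFac γ w * conj (invFac γ w)) := by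
  have h1 := invFac_ne_zero γ hw
  have h2 : invFac γ (conj w) ≠ 0 := invFac_ne_zero γ (by simpa using hw)
  rw [conj_invMoeb, conj_invFac, invMoeb, invMoeb, div_sub_div _ _ h1 h2]
  congr 1
  rw [invFac, invFac]
  linear_combination (w - conj w) * det_eq_one_complex γ

lemma invMoeb_im (γ : SL2Z) {w : ℂ} (hw : w.im ≠ 0) :
    (invMoeb γ w).im = w.im / ‖invFac γ w‖ ^ 2 := by
  have h := invMoeb_sub_conj γ hw
  rw [Complex.mul_conj, Complex.normSq_eq_norm_sq, Complex.sub_conj, Complex.sub_conj] at h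
  have := congrArg Complex.im h
  rw [Complex.div_ofReal_im] at this
  simp only [Complex.im_ofReal_mul, Complex.I_im, mul_one] at this
  linear_combination this / 2

lemma entrySum_le (γ : SL2Z) {w : ℂ} (hw : 0 < w.im) :
    entrySum γ ≤ (1 + (1 + ‖w‖) / w.im) * (‖invFac γ w‖ * (1 + ‖invMoeb γ w‖)) := by
  have key (m n : ℤ) : |(m : ℝ)| + |(n : ℝ)| ≤
      (1 + (1 + ‖w‖) / w.im) * ‖(m : ℂ) - (n : ℂ) * w‖ := by
    have h1 : |(n : ℝ)| * w.im ≤ ‖(m : ℂ) - (n : ℂ) * w‖ := by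
      have := Complex.abs_im_le_norm ((m : ℂ) - (n : ℂ) * w)
      simpa [abs_mul, abs_of_pos hw] using this
    have h2 : |(m : ℝ)| ≤ ‖(m : ℂ) - (n : ℂ) * w‖ + |(n : ℝ)| * ‖w‖ := by
      have := norm_add_le ((m : ℂ) - (n : ℂ) * w) ((n : ℂ) * w)
      simpa using this
    have h3 : |(n : ℝ)| ≤ ‖(m : ℂ) - (n : ℂ) * w‖ / w.im := (le_div_iff₀ hw).mpr h1
    calc |(m : ℝ)| + |(n : ℝ)|
        ≤ ‖(m : ℂ) - (n : ℂ) * w‖ + |(n : ℝ)| * (1 + ‖w‖) := by linarith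
      _ ≤ ‖(m : ℂ) - (n : ℂ) * w‖ + ‖(m : ℂ) - (n : ℂ) * w‖ / w.im * (1 + ‖w‖) := by gcongr
      _ = _ := by ring
  have h1 := key (γ 0 0) (γ 1 0)
  have h2 := key (γ 0 1) (γ 1 1)
  rw [← norm_sub_rev, ← invMoeb_mul_invFac γ hw.ne', norm_mul] at h2
  rw [← invFac] at h1
  rw [entrySum]
  linarith

lemma exists_segment_bound {z : ℂ} (hz : 0 < z.im) :
    ∃ c > 0, ∀ P : ℂ, P.im ≤ z.im / 2 ∨ 2 * (‖z‖ + 1) + 1 ≤ ‖P‖ →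
      ∃ r : ℝ, |r| ≤ ‖z‖ + 1 ∧ ∀ ζ ∈ segment ℝ z (r : ℂ), c * (1 + ‖P‖) ≤ ‖ζ - P‖ := by
  set d := min 1 z.im / 4 with hd
  have hd0 : 0 < d := by positivity
  have hd1 : d ≤ 1 / 4 := by rw [hd]; gcongr; exact min_le_left _ _
  have hd2 : d ≤ z.im / 4 := by rw [hd]; gcongr; exact min_le_right _ _
  refine ⟨d / (2 + ‖z‖ + d), by positivity, fun P hP => ?_⟩
  obtain ⟨s, hs, hsP⟩ : ∃ s : ℝ, |s| = 1 ∧ 0 ≤ s * (z.re - P.re) := by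
    rcases le_total P.re z.re with h | h
    · exact ⟨1, by simp, by linarith⟩
    · exact ⟨-1, by simp, by linarith⟩
  have hsr : |z.re + s| ≤ ‖z‖ + 1 :=
    (abs_add_le _ _).trans (by rw [hs]; gcongr; exact Complex.abs_re_le_norm z)
  refine ⟨z.re + s, hsr, fun ζ hζ => ?_⟩
  have hζR : ‖ζ‖ ≤ ‖z‖ + 1 := by
    have hr : ((z.re + s : ℝ) : ℂ) ∈ Metric.closedBall (0 : ℂ) (‖z‖ + 1) := by
      rwa [mem_closedBall_zero_iff, Complex.norm_real, Real.norm_eq_abs]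
    have hzm : z ∈ Metric.closedBall (0 : ℂ) (‖z‖ + 1) := by
      rw [mem_closedBall_zero_iff]; linarith
    simpa using (convex_closedBall (0 : ℂ) (‖z‖ + 1)).segment_subset hzm hr hζ
  have htri : ‖P‖ ≤ ‖ζ‖ + ‖ζ - P‖ := by
    have := norm_sub_le ζ (ζ - P)
    simpa using this
  rw [div_mul_eq_mul_div, div_le_iff₀ (by positivity)]
  rcases hP with hP | hP
  · have hdist : d ≤ ‖ζ - P‖ := by
      obtain ⟨a, t, ha, ht, hat, rfl⟩ := hζ
      obtain rfl : a = 1 - t := by linarith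
      rcases le_total (1 / 4) t with h4 | h4
      · refine le_trans ?_ (Complex.abs_re_le_norm _)
        simp only [Complex.sub_re, Complex.add_re, Complex.smul_re, Complex.ofReal_re, smul_eq_mul]
        have e : (1 - t) * z.re + t * (z.re + s) - P.re = (z.re - P.re) + t * s := by ring
        rw [e]
        have hs2 : s * s = 1 := by rw [← abs_mul_abs_self, hs, one_mul]
        calc d ≤ t := by linarith
          _ ≤ s * ((z.re - P.re) + t * s) := by nlinarith
          _ ≤ |s * ((z.re - P.re) + t * s)| := le_abs_self _
          _ = _ := by rw [abs_mul, hs, one_mul]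
      · refine le_trans ?_ ((le_abs_self _).trans (Complex.abs_im_le_norm _))
        simp only [Complex.sub_im, Complex.add_im, Complex.smul_im, Complex.ofReal_im, smul_eq_mul]
        nlinarith
    nlinarith [norm_nonneg z]
  · nlinarith [norm_nonneg z]

lemma eventually_segment_bound {z w : ℂ} (hz : 0 < z.im) (hw : 0 < w.im) :
    ∃ c > 0, ∀ᶠ γ : SL2Z in Filter.cofinite, ∃ r : ℝ, |r| ≤ ‖z‖ + 1 ∧
      ∀ ζ ∈ segment ℝ z (r : ℂ), c * (1 + ‖invMoeb γ w‖) ≤ ‖ζ - invMoeb γ w‖ := by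
  obtain ⟨c, hc, H⟩ := exists_segment_bound hz
  refine ⟨c, hc, ?_⟩
  filter_upwards [eventually_lt_entrySum ((1 + (1 + ‖w‖) / w.im) *
    (√(2 * w.im / z.im) * (2 * (‖z‖ + 1) + 2)))] with γ hγ
  refine H _ ?_
  by_contra! hcon
  obtain ⟨h1, h2⟩ := hcon
  have hmu : 0 < ‖invFac γ w‖ := norm_pos_iff.mpr (invFac_ne_zero γ hw.ne')
  have h3 : ‖invFac γ w‖ ≤ √(2 * w.im / z.im) := by
    refine Real.le_sqrt_of_sq_le ?_
    rw [invMoeb_im γ hw.ne', lt_div_iff₀ (by positivity)] at h1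
    rw [le_div_iff₀ hz]
    linarith
  refine (hγ.trans_le (entrySum_le γ hw)).not_ge ?_
  exact mul_le_mul_of_nonneg_left (mul_le_mul h3 (by linarith) (by positivity) (by positivity))
    (by positivity)

lemma exists_pos_le_of_eventually {ι : Type*} {f : ι → ℝ} (hf : ∀ i, 0 < f i) {c : ℝ}
    (hc : 0 < c) (h : ∀ᶠ i in Filter.cofinite, c ≤ f i) : ∃ c' > 0, ∀ i, c' ≤ f i := by
  rcases Set.eq_empty_or_nonempty {i | ¬c ≤ f i} with he | hne
  · exact ⟨c, hc, fun i => by_contra fun hi => Set.notMem_empty i (he ▸ hi)⟩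
  · obtain ⟨j, -, hj⟩ := Set.exists_min_image _ f (Filter.eventually_cofinite.mp h) hne
    refine ⟨min c (f j), lt_min hc (hf j), fun i => ?_⟩
    by_cases hi : c ≤ f i
    · exact (min_le_left _ _).trans hi
    · exact (min_le_right _ _).trans (hj i hi)

lemma exists_orbit_bound (Γ : Subgroup SL2Z) {z w : ℂ} (hz : 0 < z.im) (hw : 0 < w.im)
    (h : ∀ γ : Γ, z ≠ invMoeb γ w) :
    ∃ c > 0, ∀ γ : Γ, c * (1 + ‖invMoeb γ w‖) ≤ ‖z - invMoeb γ w‖ := by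
  obtain ⟨c, hc, H⟩ := eventually_segment_bound hz hw
  have hpos (γ : SL2Z) : 0 < 1 + ‖invMoeb γ w‖ := by positivity
  obtain ⟨c', hc', H'⟩ := exists_pos_le_of_eventually
    (f := fun γ : Γ => ‖z - invMoeb γ w‖ / (1 + ‖invMoeb γ w‖))
    (fun γ => div_pos (norm_pos_iff.mpr (sub_ne_zero.mpr (h γ))) (hpos γ)) hc <| by
      filter_upwards [Subtype.val_injective.tendsto_cofinite.eventually H] with γ ⟨r, _, hr⟩
      exact (le_div_iff₀ (hpos γ)).mpr (hr z (left_mem_segment ℝ _ _))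
  exact ⟨c', hc', fun γ => (le_div_iff₀ (hpos γ)).mp (H' γ)⟩

lemma invFac_pairing (γ : SL2Z) (u v : ℂ) {w : ℂ} (hw : w.im ≠ 0) :
    (γ 1 1 * u - γ 0 1 * v) - invMoeb γ w * (γ 0 0 * v - γ 1 0 * u) =
      (u - w * v) / invFac γ w := by
  have hm := invFac_ne_zero γ hw
  rw [eq_div_iff hm, sub_mul, mul_right_comm, invMoeb_mul_invFac γ hw, invFac]
  linear_combination (u - w * v) * det_eq_one_complex γ

lemma entC_eq (γ : SL2Z) (i j : Fin 2) : entC γ i j = (γ i j : ℂ) := by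
  simp [entC, toRealM]

lemma jFac_toRealM (γ : SL2Z) (ζ : ℂ) :
    jFac (toRealM γ) ζ = (γ 1 0 : ℂ) * ζ + (γ 1 1 : ℂ) := by
  simp [jFac, toRealM]

lemma moeb_toRealM (γ : SL2Z) (ζ : ℂ) :
    moeb (toRealM γ) ζ = ((γ 0 0 : ℂ) * ζ + (γ 0 1 : ℂ)) / jFac (toRealM γ) ζ := by
  simp [moeb, jFac, toRealM]

lemma conj_moeb (γ : SL2Z) (ζ : ℂ) : conj (moeb (toRealM γ) ζ) = moeb (toRealM γ) (conj ζ) := by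
  simp [moeb]

lemma jFac_ne_zero (γ : SL2Z) {ζ : ℂ} (hζ : ζ.im ≠ 0) : jFac (toRealM γ) ζ ≠ 0 := by
  rw [jFac_toRealM]
  intro h
  have him := congrArg Complex.im h
  have hre := congrArg Complex.re h
  simp [hζ] at him
  simp [him] at hre
  have := det_eq_one γ
  simp [him, hre] at this

lemma moeb_sub (γ : SL2Z) {ζ w : ℂ} (hζ : ζ.im ≠ 0) (hw : w.im ≠ 0) :
    moeb (toRealM γ) ζ - w =
      invFac γ w * (ζ - invMoeb γ w) / jFac (toRealM γ) ζ := by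
  rw [moeb_toRealM, div_sub' (jFac_ne_zero γ hζ)]
  congr 1
  rw [jFac_toRealM, mul_sub, mul_comm _ (invMoeb γ w), invMoeb_mul_invFac γ hw, invFac]
  ring

lemma pkF_moeb (k : ℕ) (x y u v : ℂ) (γ : SL2Z) {ζ w : ℂ} (hζ : ζ.im ≠ 0) (hw : w.im ≠ 0) :
    pkF k (entC γ 0 0 * x + entC γ 0 1 * y) (entC γ 1 0 * x + entC γ 1 1 * y) u v
        (moeb (toRealM γ) ζ) w =
      pkF k x y (γ 1 1 * u - γ 0 1 * v) (γ 0 0 * v - γ 1 0 * u) ζ (invMoeb γ w) := by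
  have hj := jFac_ne_zero γ hζ
  have hm := invFac_ne_zero γ hw
  have hdet := det_eq_one_complex γ
  have hL : v * (γ 0 0 * x + γ 0 1 * y) - u * (γ 1 0 * x + γ 1 1 * y) =
      (γ 0 0 * v - γ 1 0 * u) * x - (γ 1 1 * u - γ 0 1 * v) * y := by ring
  have hX : γ 0 0 * x + γ 0 1 * y - moeb (toRealM γ) ζ * (γ 1 0 * x + γ 1 1 * y) =
      (x - ζ * y) / jFac (toRealM γ) ζ := by
    rw [moeb_toRealM, eq_div_iff hj]
    field_simp
    rw [jFac_toRealM]
    linear_combination (x - ζ * y) * hdet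
  have hU := invFac_pairing γ u v hw
  simp only [pkF, entC_eq, hL, hX, hU, moeb_sub γ hζ hw]
  congr 1
  refine Finset.sum_congr rfl fun p _ => ?_
  congr 3
  rw [div_mul_eq_mul_div, div_div_div_cancel_right₀ hj, ← mul_div_assoc, div_div]

lemma gkF_moeb (k : ℕ) (x y u v : ℂ) (γ : SL2Z) {ζ w : ℂ} (hζ : ζ.im ≠ 0) (hw : w.im ≠ 0) :
    gkF k (entC γ 0 0 * x + entC γ 0 1 * y) (entC γ 1 0 * x + entC γ 1 1 * y) u v
        (moeb (toRealM γ) ζ) w =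
      gkF k x y (γ 1 1 * u - γ 0 1 * v) (γ 0 0 * v - γ 1 0 * u) ζ (invMoeb γ w) := by
  have hζ' : (conj ζ).im ≠ 0 := by simpa using hζ
  have hw' : (conj w).im ≠ 0 := by simpa using hw
  have hL : v * (entC γ 0 0 * x + entC γ 0 1 * y) - u * (entC γ 1 0 * x + entC γ 1 1 * y) =
      (γ 0 0 * v - γ 1 0 * u) * x - (γ 1 1 * u - γ 0 1 * v) * y := by
    simp only [entC_eq]; ring
  have hlog : normSq (moeb (toRealM γ) ζ - w) / normSq (moeb (toRealM γ) ζ - conj w) =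
      normSq (ζ - invMoeb γ w) / normSq (ζ - conj (invMoeb γ w)) := by
    rw [moeb_sub γ hζ hw, moeb_sub γ hζ hw', conj_invMoeb, ← conj_invFac]
    simp only [map_mul, map_div₀, normSq_conj]
    rw [div_div_div_cancel_right₀ (by simpa using jFac_ne_zero γ hζ),
      mul_div_mul_left _ _ (by simpa using invFac_ne_zero γ hw)]
  rw [gkF, gkF, hL, hlog, conj_moeb, pkF_moeb k x y u v γ hζ hw, pkF_moeb k x y u v γ hζ hw',
    pkF_moeb k x y u v γ hζ' hw, pkF_moeb k x y u v γ hζ' hw', conj_invMoeb]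

/-- The `γ`-th term of the Poincaré series `Ψ^{p,q}`, written in terms of `γ⁻¹·w`. -/
def psiTerm (p q : ℕ) (γ : SL2Z) (z w : ℂ) : ℂ :=
  psiPQ p q z (invMoeb γ w) / (invFac γ w ^ p * conj (invFac γ w) ^ q)

lemma psiTerm_eq (p q : ℕ) (γ : SL2Z) {z w : ℂ} (hw : w.im ≠ 0) :
    psiTerm p q γ z w = (w - conj w) /
      ((invFac γ w * (z - invMoeb γ w)) ^ (p + 1) *
        (conj (invFac γ w) * (z - conj (invMoeb γ w))) ^ (q + 1)) := by
  rw [psiTerm, psiPQ, invMoeb_sub_conj γ hw]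
  norm_cast
  rw [div_div, div_div]
  congr 1
  simp only [mul_pow]
  ring

lemma psiTerm_eq_slash (p q : ℕ) (γ : SL2Z) {z w : ℂ} (hz : z.im ≠ 0) (hw : w.im ≠ 0) :
    jFac (toRealM γ) z ^ (-((p : ℤ) + q + 2)) * psiPQ p q (moeb (toRealM γ) z) w =
      psiTerm p q γ z w := by
  have hw' : (conj w).im ≠ 0 := by simpa using hw
  have hj := jFac_ne_zero γ hz
  rw [psiTerm_eq p q γ hw, psiPQ, moeb_sub γ hz hw, moeb_sub γ hz hw', conj_invMoeb,
    conj_invFac, zpow_neg]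
  norm_cast
  rw [div_pow, div_pow, div_mul_div_comm, ← pow_add, show p + 1 + (q + 1) = p + q + 2 by ring]
  rw [div_div_eq_mul_div, ← mul_div_assoc, mul_comm (w - _),
    inv_mul_cancel_left₀ (pow_ne_zero _ hj)]

lemma hasFDerivAt_gkF_invMoeb (k : ℕ) (x y u v : ℂ) (γ : SL2Z) {z w : ℂ} (hw : w.im ≠ 0)
    (h : z ≠ invMoeb γ w) (h' : z ≠ conj (invMoeb γ w)) :
    HasFDerivAt
      (fun ζ => gkF k x y (γ 1 1 * u - γ 0 1 * v) (γ 0 0 * v - γ 1 0 * u) ζ (invMoeb γ w))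
      (wirt
        ((x - z * y) ^ k * ∑ p ∈ Finset.range (k + 1),
          psiTerm p (k - p) γ z w * (u - w * v) ^ p * (u - conj w * v) ^ (k - p))
        ((x - conj z * y) ^ k * ∑ p ∈ Finset.range (k + 1),
          conj (psiTerm (k - p) p γ z w) * (u - w * v) ^ p * (u - conj w * v) ^ (k - p))) z := by
  refine (hasFDerivAt_gkF k x y _ _ h h').congr_fderiv ?_
  have hU := invFac_pairing γ u v hw
  have hU' := invFac_pairing γ u v (w := conj w) (by simpa using hw)
  rw [← conj_invMoeb, ← conj_invFac] at hU'
  congr 2 <;> refine Finset.sum_congr rfl fun p _ => ?_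
  · rw [hU, hU', psiTerm]
    simp only [div_pow]
    ring
  · rw [hU, hU', psiTerm]
    simp only [div_pow, map_div₀, map_mul, map_pow, Complex.conj_conj]
    ring

lemma norm_psiTerm_le (p q : ℕ) (hpq : 1 ≤ p + q) (γ : SL2Z) {z w : ℂ} (hz : 0 ≤ z.im)
    (hw : 0 < w.im) {c : ℝ} (hc : 0 < c)
    (h : c * (1 + ‖invMoeb γ w‖) ≤ ‖z - invMoeb γ w‖) :
    ‖psiTerm p q γ z w‖ ≤
      2 * w.im * ((1 + (1 + ‖w‖) / w.im) / c) ^ (p + q + 2) * (entrySum γ)⁻¹ ^ 3 := by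
  set K := 1 + (1 + ‖w‖) / w.im with hK
  have hKpos : 0 < K := by positivity
  have hN := one_le_entrySum γ
  have hP : 0 ≤ (invMoeb γ w).im := by rw [invMoeb_im γ hw.ne']; positivity
  have h' : ‖z - invMoeb γ w‖ ≤ ‖z - conj (invMoeb γ w)‖ := by
    rw [← sq_le_sq₀ (norm_nonneg _) (norm_nonneg _), ← Complex.normSq_eq_norm_sq,
      ← Complex.normSq_eq_norm_sq, Complex.normSq_apply, Complex.normSq_apply]
    simp only [Complex.sub_re, Complex.sub_im, Complex.conj_re, Complex.conj_im]
    nlinarith [mul_nonneg hz hP]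
  have hlow : c / K * entrySum γ ≤ ‖invFac γ w‖ * ‖z - invMoeb γ w‖ := by
    rw [div_mul_eq_mul_div, div_le_iff₀ hKpos]
    calc c * entrySum γ ≤ c * (K * (‖invFac γ w‖ * (1 + ‖invMoeb γ w‖))) := by
          gcongr; exact entrySum_le γ hw
      _ = ‖invFac γ w‖ * (c * (1 + ‖invMoeb γ w‖)) * K := by ring
      _ ≤ _ := by gcongr
  have hlow' : c / K * entrySum γ ≤ ‖invFac γ w‖ * ‖z - conj (invMoeb γ w)‖ :=
    hlow.trans (by gcongr)
  have hpos : 0 < c / K * entrySum γ := by positivity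
  have hnum : ‖w - conj w‖ = 2 * w.im := by
    rw [Complex.sub_conj]
    simp [abs_of_pos hw]
  rw [psiTerm_eq p q γ hw.ne', norm_div, norm_mul, norm_pow, norm_pow, norm_mul, norm_mul,
    Complex.norm_conj, hnum]
  calc 2 * w.im / ((‖invFac γ w‖ * ‖z - invMoeb γ w‖) ^ (p + 1) *
        (‖invFac γ w‖ * ‖z - conj (invMoeb γ w)‖) ^ (q + 1))
      ≤ 2 * w.im / ((c / K * entrySum γ) ^ (p + 1) * (c / K * entrySum γ) ^ (q + 1)) := by
        gcongr
    _ = 2 * w.im * (K / c) ^ (p + q + 2) * (entrySum γ)⁻¹ ^ (p + q + 2) := by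
        rw [← pow_add, show p + 1 + (q + 1) = p + q + 2 by ring, div_eq_mul_inv, ← inv_pow,
          mul_inv, inv_div, mul_pow]
        ring
    _ ≤ _ := by
        gcongr ?_ * ?_
        exact pow_le_pow_of_le_one (by positivity) (inv_le_one_of_one_le₀ hN) (by omega)

lemma norm_wirt_le (a b : ℂ) : ‖wirt a b‖ ≤ ‖a‖ + ‖b‖ := by
  refine ContinuousLinearMap.opNorm_le_bound _ (by positivity) fun ν => ?_
  rw [wirt_apply]
  refine (norm_add_le _ _).trans ?_
  rw [norm_mul, norm_mul, Complex.norm_conj, add_mul]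

lemma gkF_ofReal (k : ℕ) (x y u v : ℂ) (r : ℝ) {w : ℂ} (hw : w.im ≠ 0) :
    gkF k x y u v r w = 0 := by
  have hr : normSq ((r : ℂ) - w) = normSq ((r : ℂ) - conj w) := by
    rw [← normSq_conj ((r : ℂ) - w)]; simp
  have h0 : normSq ((r : ℂ) - conj w) ≠ 0 := by
    rw [Ne, normSq_eq_zero, sub_eq_zero]
    intro e
    have := congrArg Complex.im e
    simp at this
    exact hw this
  simp [gkF, hr, div_self h0]

lemma exists_norm_wirt_le (k : ℕ) (hk : 1 ≤ k) (x y u v : ℂ) {w : ℂ} (hw : 0 < w.im) {c : ℝ}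
    (hc : 0 < c) (R : ℝ) :
    ∃ C : ℝ, ∀ (γ : SL2Z) (ζ : ℂ), 0 ≤ ζ.im → ‖ζ‖ ≤ R →
      c * (1 + ‖invMoeb γ w‖) ≤ ‖ζ - invMoeb γ w‖ →
      ‖wirt
        ((x - ζ * y) ^ k * ∑ p ∈ Finset.range (k + 1),
          psiTerm p (k - p) γ ζ w * (u - w * v) ^ p * (u - conj w * v) ^ (k - p))
        ((x - conj ζ * y) ^ k * ∑ p ∈ Finset.range (k + 1),
          conj (psiTerm (k - p) p γ ζ w) * (u - w * v) ^ p * (u - conj w * v) ^ (k - p))‖ ≤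
        C * (entrySum γ)⁻¹ ^ 3 := by
  set E := 2 * w.im * ((1 + (1 + ‖w‖) / w.im) / c) ^ (k + 2) with hE
  set S := ∑ p ∈ Finset.range (k + 1), E * ‖u - w * v‖ ^ p * ‖u - conj w * v‖ ^ (k - p) with hS
  refine ⟨(‖x‖ + R * ‖y‖) ^ k * S + (‖x‖ + R * ‖y‖) ^ k * S, fun γ ζ hζ hζR hγ => ?_⟩
  have hX (s : ℂ) (hs : ‖s‖ ≤ R) : ‖(x - s * y) ^ k‖ ≤ (‖x‖ + R * ‖y‖) ^ k := by
    rw [norm_pow]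
    gcongr
    refine (norm_sub_le _ _).trans ?_
    rw [norm_mul]
    gcongr
  have hsum (f : ℕ → ℂ) (hf : ∀ p ∈ Finset.range (k + 1), ‖f p‖ ≤ E * (entrySum γ)⁻¹ ^ 3) :
      ‖∑ p ∈ Finset.range (k + 1), f p * (u - w * v) ^ p * (u - conj w * v) ^ (k - p)‖ ≤
        S * (entrySum γ)⁻¹ ^ 3 := by
    rw [hS, Finset.sum_mul]
    refine norm_sum_le_of_le _ fun p hp => ?_
    rw [norm_mul, norm_mul, norm_pow, norm_pow]
    calc _ ≤ E * (entrySum γ)⁻¹ ^ 3 * ‖u - w * v‖ ^ p * ‖u - conj w * v‖ ^ (k - p) := by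
          gcongr; exact hf p hp
      _ = _ := by ring
  have hR : 0 ≤ R := (norm_nonneg ζ).trans hζR
  have hpsi (p q : ℕ) (hpq : p + q = k) : ‖psiTerm p q γ ζ w‖ ≤ E * (entrySum γ)⁻¹ ^ 3 := by
    rw [hE, ← hpq]
    exact norm_psiTerm_le p q (hpq ▸ hk) γ hζ hw hc hγ
  refine (norm_wirt_le _ _).trans ?_
  rw [norm_mul, norm_mul, add_mul, mul_assoc]
  gcongr ?_ * ?_ + ?_ * ?_
  · exact hX ζ hζR
  · refine hsum _ fun p hp => hpsi _ _ ?_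
    have := Finset.mem_range.mp hp
    omega
  · exact hX _ (by rwa [Complex.norm_conj])
  · refine hsum _ fun p hp => ?_
    rw [Complex.norm_conj]
    refine hpsi _ _ ?_
    have := Finset.mem_range.mp hp
    omega

lemma ne_conj_invMoeb (γ : SL2Z) {ζ w : ℂ} (hζ : 0 ≤ ζ.im) (hw : 0 < w.im) :
    ζ ≠ conj (invMoeb γ w) := by
  intro e
  have him := congrArg Complex.im e
  have : 0 < ‖invFac γ w‖ := norm_pos_iff.mpr (invFac_ne_zero γ hw.ne')
  have hpos : 0 < (invMoeb γ w).im := by rw [invMoeb_im γ hw.ne']; positivity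
  rw [Complex.conj_im] at him
  linarith

lemma ne_invMoeb_of_le {γ : SL2Z} {ζ w : ℂ} {c : ℝ} (hc : 0 < c)
    (h : c * (1 + ‖invMoeb γ w‖) ≤ ‖ζ - invMoeb γ w‖) : ζ ≠ invMoeb γ w := by
  intro e
  rw [← e, sub_self, norm_zero] at h
  have : 0 < c * (1 + ‖ζ‖) := by positivity
  linarith

lemma summable_gkF_invMoeb (k : ℕ) (hk : 1 ≤ k) (x y u v : ℂ) {z w : ℂ} (hz : 0 < z.im)
    (hw : 0 < w.im) :
    Summable fun γ : SL2Z =>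
      gkF k x y (γ 1 1 * u - γ 0 1 * v) (γ 0 0 * v - γ 1 0 * u) z (invMoeb γ w) := by
  obtain ⟨c, hc, H⟩ := eventually_segment_bound hz hw
  obtain ⟨C, hC⟩ := exists_norm_wirt_le k hk x y u v hw hc (‖z‖ + 1)
  refine (summable_entrySum_inv_cube.mul_left (|C| * (2 * ‖z‖ + 1))).of_norm_bounded_eventually ?_
  filter_upwards [H] with γ ⟨r, hr, hseg⟩
  have him : ∀ ζ ∈ segment ℝ z (r : ℂ), 0 ≤ ζ.im := fun ζ hζ =>
    (convex_halfSpace_im_ge 0).segment_subset (show z ∈ {ζ : ℂ | 0 ≤ ζ.im} from hz.le)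
      (show (r : ℂ) ∈ {ζ : ℂ | 0 ≤ ζ.im} by simp) hζ
  have hnorm : ∀ ζ ∈ segment ℝ z (r : ℂ), ‖ζ‖ ≤ ‖z‖ + 1 := fun ζ hζ => by
    simpa using (convex_closedBall (0 : ℂ) (‖z‖ + 1)).segment_subset
      (show z ∈ _ by rw [mem_closedBall_zero_iff]; linarith)
      (show (r : ℂ) ∈ _ by rwa [mem_closedBall_zero_iff, Complex.norm_real]) hζ
  have hmv := (convex_segment z (r : ℂ)).norm_image_sub_le_of_norm_hasFDerivWithin_le
    (fun ζ hζ => (hasFDerivAt_gkF_invMoeb k x y u v γ hw.ne' (ne_invMoeb_of_le hc (hseg ζ hζ))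
      (ne_conj_invMoeb γ (him ζ hζ) hw)).hasFDerivWithinAt)
    (fun ζ hζ => hC γ ζ (him ζ hζ) (hnorm ζ hζ) (hseg ζ hζ))
    (right_mem_segment ℝ z (r : ℂ)) (left_mem_segment ℝ z (r : ℂ))
  have himP : (invMoeb γ w).im ≠ 0 := by
    rw [invMoeb_im γ hw.ne']
    have := norm_pos_iff.mpr (invFac_ne_zero γ hw.ne')
    positivity
  rw [gkF_ofReal k x y _ _ r himP, sub_zero] at hmv
  have hN := one_le_entrySum γ
  refine hmv.trans ?_
  calc C * (entrySum γ)⁻¹ ^ 3 * ‖z - r‖ ≤ |C| * (entrySum γ)⁻¹ ^ 3 * (2 * ‖z‖ + 1) := by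
        gcongr
        · exact le_abs_self C
        · refine (norm_sub_le _ _).trans ?_
          rw [Complex.norm_real, Real.norm_eq_abs]
          linarith
    _ = _ := by ring

lemma HasSum.wirt {ι : Type*} {f g : ι → ℂ} {a b : ℂ} (hf : HasSum f a) (hg : HasSum g b) :
    HasSum (fun i => wirt (f i) (g i)) (wirt a b) :=
  (hf.smul_const _).add (hg.smul_const _)

lemma orbit_bound_of_mem_ball (Γ : Subgroup SL2Z) {z w : ℂ} {c : ℝ} (hc : 0 < c)
    (hcz : ∀ γ : Γ, c * (1 + ‖invMoeb γ w‖) ≤ ‖z - invMoeb γ w‖) {ζ : ℂ}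
    (hζ : ζ ∈ Metric.ball z (min (c / 2) z.im)) :
    0 < ζ.im ∧ ∀ γ : Γ, c / 2 * (1 + ‖invMoeb γ w‖) ≤ ‖ζ - invMoeb γ w‖ := by
  rw [mem_ball_iff_norm, lt_min_iff] at hζ
  refine ⟨?_, fun γ => ?_⟩
  · have := (Complex.abs_im_le_norm (ζ - z)).trans_lt hζ.2
    rw [Complex.sub_im, abs_lt] at this
    linarith
  · have h1 := norm_sub_norm_le (z - invMoeb γ w) (z - ζ)
    rw [sub_sub_sub_cancel_left, norm_sub_rev z ζ] at h1
    have h2 := hcz γ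
    have h3 := mul_nonneg hc.le (norm_nonneg (invMoeb γ w))
    linarith

lemma hasSum_psiTerm (Γ : Subgroup SL2Z) {p q : ℕ} (hpq : 1 ≤ p + q) {z w : ℂ} (hz : 0 < z.im)
    (hw : 0 < w.im) {c : ℝ} (hc : 0 < c)
    (hcz : ∀ γ : Γ, c * (1 + ‖invMoeb γ w‖) ≤ ‖z - invMoeb γ w‖) :
    HasSum (fun γ : Γ => psiTerm p q γ z w) (PsiS Γ p q z w) := by
  have hcubes := summable_entrySum_inv_cube.comp_injective
    (Subtype.val_injective (p := fun γ => γ ∈ Γ))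
  have hs : Summable fun γ : Γ => psiTerm p q γ z w :=
    (hcubes.mul_left _).of_norm_bounded fun γ =>
      norm_psiTerm_le p q hpq γ hz.le hw hc (hcz γ)
  convert hs.hasSum using 1
  exact tsum_congr fun γ => psiTerm_eq_slash p q γ hz.ne' hw.ne'

lemma hasFDerivAt_tsum_gkF_invMoeb (Γ : Subgroup SL2Z) (k : ℕ) (hk : 1 ≤ k) (x y u v : ℂ)
    {z w : ℂ} (hz : 0 < z.im) (hw : 0 < w.im) {c : ℝ} (hc : 0 < c)
    (hcz : ∀ γ : Γ, c * (1 + ‖invMoeb γ w‖) ≤ ‖z - invMoeb γ w‖) :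
    HasFDerivAt
      (fun ζ => ∑' γ : Γ, gkF k x y ((γ : SL2Z) 1 1 * u - (γ : SL2Z) 0 1 * v)
        ((γ : SL2Z) 0 0 * v - (γ : SL2Z) 1 0 * u) ζ (invMoeb γ w))
      (∑' γ : Γ, wirt
        ((x - z * y) ^ k * ∑ p ∈ Finset.range (k + 1),
          psiTerm p (k - p) γ z w * (u - w * v) ^ p * (u - conj w * v) ^ (k - p))
        ((x - conj z * y) ^ k * ∑ p ∈ Finset.range (k + 1),
          conj (psiTerm (k - p) p γ z w) * (u - w * v) ^ p * (u - conj w * v) ^ (k - p))) z := by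
  have hcubes := summable_entrySum_inv_cube.comp_injective
    (Subtype.val_injective (p := fun γ => γ ∈ Γ))
  have hball {ζ : ℂ} := orbit_bound_of_mem_ball Γ hc hcz (ζ := ζ)
  have hzball : z ∈ Metric.ball z (min (c / 2) z.im) := Metric.mem_ball_self (by positivity)
  obtain ⟨C, hC⟩ := exists_norm_wirt_le k hk x y u v hw (half_pos hc) (‖z‖ + z.im)
  exact hasFDerivAt_tsum_of_isPreconnected (hcubes.mul_left C) Metric.isOpen_ball
    (convex_ball z (min (c / 2) z.im)).isPreconnected
    (fun (γ : Γ) ζ hζ => hasFDerivAt_gkF_invMoeb k x y u v γ hw.ne'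
      (ne_invMoeb_of_le (half_pos hc) ((hball hζ).2 γ))
      (ne_conj_invMoeb γ (hball hζ).1.le hw))
    (fun γ ζ hζ => hC γ ζ (hball hζ).1.le
      (by
        have h1 := norm_add_le z (ζ - z)
        rw [mem_ball_iff_norm, lt_min_iff] at hζ
        rw [add_sub_cancel] at h1
        linarith)
      ((hball hζ).2 γ))
    hzball ((summable_gkF_invMoeb k hk x y u v hz hw).comp_injective Subtype.val_injective) hzball

theorem statement_15
    (Γ : Subgroup SL2Z) (hΓ : Γ.FiniteIndex) (k : ℕ) (hk : 1 ≤ k)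
    (x y u v : ℂ) (z w : ℂ) (hz : 0 < z.im) (hw : 0 < w.im)
    (h : ∀ γ : Γ, moeb (toRealM ↑γ) z ≠ w) :
    Summable (fun γ : Γ =>
      gkF k (entC ↑γ 0 0 * x + entC ↑γ 0 1 * y) (entC ↑γ 1 0 * x + entC ↑γ 1 1 * y)
        u v (moeb (toRealM ↑γ) z) w) ∧
    HasFDerivAt
      (fun ζ : ℂ => ∑' γ : Γ,
        gkF k (entC ↑γ 0 0 * x + entC ↑γ 0 1 * y) (entC ↑γ 1 0 * x + entC ↑γ 1 1 * y)
          u v (moeb (toRealM ↑γ) ζ) w)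
      (wirt
        ((x - z * y) ^ k * ∑ p ∈ Finset.range (k + 1),
          PsiS Γ (p : ℤ) ((k - p : ℕ) : ℤ) z w * (u - w * v) ^ p * (u - conj w * v) ^ (k - p))
        ((x - conj z * y) ^ k * ∑ p ∈ Finset.range (k + 1),
          conj (PsiS Γ ((k - p : ℕ) : ℤ) (p : ℤ) z w) * (u - w * v) ^ p *
            (u - conj w * v) ^ (k - p)))
      z := by
  have hne (γ : Γ) : z ≠ invMoeb γ w := fun e => h γ <| by
    rw [← sub_eq_zero, moeb_sub _ hz.ne' hw.ne', ← e]
    simp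
  obtain ⟨c, hc, hcz⟩ := exists_orbit_bound Γ hz hw hne
  have hA : HasSum (fun γ : Γ => ∑ p ∈ Finset.range (k + 1),
        psiTerm p (k - p) γ z w * (u - w * v) ^ p * (u - conj w * v) ^ (k - p))
      (∑ p ∈ Finset.range (k + 1),
        PsiS Γ (p : ℤ) ((k - p : ℕ) : ℤ) z w * (u - w * v) ^ p * (u - conj w * v) ^ (k - p)) :=
    hasSum_sum fun p hp => ((hasSum_psiTerm Γ (by
      have := Finset.mem_range.mp hp
      omega) hz hw hc hcz).mul_right _).mul_right _
  have hB : HasSum (fun γ : Γ => ∑ p ∈ Finset.range (k + 1),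
        conj (psiTerm (k - p) p γ z w) * (u - w * v) ^ p * (u - conj w * v) ^ (k - p))
      (∑ p ∈ Finset.range (k + 1),
        conj (PsiS Γ ((k - p : ℕ) : ℤ) (p : ℤ) z w) * (u - w * v) ^ p *
          (u - conj w * v) ^ (k - p)) :=
    hasSum_sum fun p hp => ((Complex.hasSum_conj'.mpr (hasSum_psiTerm Γ (by
      have := Finset.mem_range.mp hp
      omega) hz hw hc hcz)).mul_right _).mul_right _
  refine ⟨((summable_gkF_invMoeb k hk x y u v hz hw).comp_injective
    Subtype.val_injective).congr fun γ => (gkF_moeb k x y u v γ hz.ne' hw.ne').symm, ?_⟩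
  refine ((hasFDerivAt_tsum_gkF_invMoeb Γ k hk x y u v hz hw hc hcz).congr_fderiv
    (HasSum.wirt (hA.mul_left ((x - z * y) ^ k))
      (hB.mul_left ((x - conj z * y) ^ k))).tsum_eq).congr_of_eventuallyEq ?_
  filter_upwards [(isOpen_lt continuous_const Complex.continuous_im).mem_nhds hz] with ζ hζ
  exact tsum_congr fun γ => gkF_moeb k x y u v γ (ne_of_gt hζ) hw.ne'
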